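/- arXiv:1501.07631 — 4 statements merged into one kernel-verified Lean document; each statement's English description precedes it below -/
import Mathlib

section
/- Let R be a local ring containing 1/2 whose residue field has 3 or 5 elements, and let (W,ψ) be a quadratic space of rank ≥ 3 over R. Let b ∈ R^× and consider q(t,w) = b·t² + ψ(w) on R ⊕ W. Then for every unit a of R represented by q there exist s ∈ R and w ∈ W such that ψ(w) is a unit in R and a = b·s² + ψ(w). -/
open scoped TensorProduct

/-- A quadratic space over `R`: a finite-rank free `R`-module equipped with a quadratic
form whose polar (associated symmetric bilinear) form is nondegenerate (unimodular). -/
structure QuadSpace (R : Type) [CommRing R] : Type 1 where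
  V : Type
  [acg : AddCommGroup V]
  [mod : Module R V]
  [free : Module.Free R V]
  [fin : Module.Finite R V]
  q : QuadraticForm R V
  nondeg : Function.Bijective (QuadraticMap.polarBilin q)

attribute [instance] QuadSpace.acg QuadSpace.mod QuadSpace.free QuadSpace.fin

open IsLocalRing

section

variable {R V : Type*} [CommRing R] [AddCommGroup V] [Module R V]

theorem QuadraticMap.map_smul_add_smul (Q : QuadraticForm R V) (r s : R) (v w : V) :
    Q (r • v + s • w) = r ^ 2 * Q v + s ^ 2 * Q w + r * s * QuadraticMap.polar Q v w := by
  rw [QuadraticMap.map_add Q, QuadraticMap.map_smul, QuadraticMap.map_smul,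
    QuadraticMap.polar_smul_left, QuadraticMap.polar_smul_right]
  simp only [smul_eq_mul]
  ring

variable [IsLocalRing R]

theorem QuadraticMap.exists_isUnit_of_isUnit_polar (Q : QuadraticForm R V) {v w : V}
    (h : IsUnit (QuadraticMap.polar Q v w)) : ∃ r s : R, IsUnit (Q (r • v + s • w)) := by
  by_contra! hn
  have hv := (mem_maximalIdeal _).2 (hn 1 0)
  have hw := (mem_maximalIdeal _).2 (hn 0 1)
  have hvw := (mem_maximalIdeal _).2 (hn 1 1)
  simp only [one_smul, zero_smul, add_zero, zero_add] at hv hw hvw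
  exact (mem_maximalIdeal _).1 (Ideal.sub_mem _ (Ideal.sub_mem _ hvw hv) hw) h

/-- A quadratic form over a local ring containing `1/2` whose polar form restricts to a perfect
pairing on two pairs of vectors takes unit values on two orthogonal vectors. -/
theorem QuadraticMap.exists_orthogonal_isUnit (h2 : IsUnit (2 : R)) (Q : QuadraticForm R V)
    {e₀ e₁ z₀ z₁ : V} (h00 : QuadraticMap.polar Q z₀ e₀ = 1)
    (h01 : QuadraticMap.polar Q z₀ e₁ = 0) (h11 : QuadraticMap.polar Q z₁ e₁ = 1) :
    ∃ x y : V, IsUnit (Q x) ∧ IsUnit (Q y) ∧ QuadraticMap.polar Q x y = 0 := by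
  obtain ⟨r, s, hx⟩ := Q.exists_isUnit_of_isUnit_polar (h00 ▸ isUnit_one)
  set x := r • z₀ + s • e₀
  obtain ⟨c, hc⟩ := (h2.mul hx).exists_right_inv
  set p : V → V := fun v => v - (c * QuadraticMap.polar Q x v) • x with hp
  have hself : QuadraticMap.polar Q x x = 2 * Q x := by simp [QuadraticMap.polar_self]
  have hxp (v : V) : QuadraticMap.polar Q x (p v) = 0 := by
    simp only [hp, QuadraticMap.polar_sub_right, QuadraticMap.polar_smul_right, smul_eq_mul, hself]
    linear_combination -QuadraticMap.polar Q x v * hc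
  have hpp (v w : V) : QuadraticMap.polar Q (p v) (p w) = QuadraticMap.polar Q v w -
      c * QuadraticMap.polar Q x v * QuadraticMap.polar Q x w := by
    have : QuadraticMap.polar Q (p v) (p w) = QuadraticMap.polar Q v (p w) := by
      conv_lhs => rw [hp]
      simp only
      rw [QuadraticMap.polar_sub_left, QuadraticMap.polar_smul_left]
      have := hxp w
      simp only [hp] at this
      rw [this, smul_zero, sub_zero]
    rw [this]
    simp only [hp, QuadraticMap.polar_sub_right, QuadraticMap.polar_smul_right, smul_eq_mul]
    rw [QuadraticMap.polar_comm Q v x]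
    ring
  suffices ∃ v w, IsUnit (QuadraticMap.polar Q (p v) (p w)) by
    obtain ⟨v, w, h⟩ := this
    obtain ⟨r', s', hy⟩ := Q.exists_isUnit_of_isUnit_polar h
    refine ⟨x, _, hx, hy, ?_⟩
    simp [QuadraticMap.polar_add_right, QuadraticMap.polar_smul_right, hxp]
  by_contra! hn
  have hres (v w : V) : residue R (QuadraticMap.polar Q v w) =
      residue R (c * QuadraticMap.polar Q x v * QuadraticMap.polar Q x w) := by
    have := (residue_eq_zero_iff _).2 ((mem_maximalIdeal _).2 (hn v w))
    rwa [hpp, map_sub, sub_eq_zero] at this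
  have k00 := hres z₀ e₀
  have k01 := hres z₀ e₁
  have k11 := hres z₁ e₁
  simp only [h00, h01, h11, map_one, map_zero, map_mul] at k00 k01 k11
  rcases mul_eq_zero.1 k01.symm with h | h
  · simp [h] at k00
  · simp [h] at k11

theorem QuadraticMap.exists_residue_eq [Finite (ResidueField R)] (h2 : IsUnit (2 : R))
    (Q : QuadraticForm R V) {x y : V} (hx : IsUnit (Q x)) (hy : IsUnit (Q y))
    (hxy : QuadraticMap.polar Q x y = 0) (c : R) : ∃ u : V, residue R (Q u) = residue R c := by
  have := Fintype.ofFinite (ResidueField R)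
  have hchar : ringChar (ResidueField R) ≠ 2 := by
    intro h
    apply (h2.map (residue R)).ne_zero
    rw [map_ofNat, ← Nat.cast_ofNat, ← h, ringChar.Nat.cast_ringChar]
  have hdeg {α : ResidueField R} (hα : α ≠ 0) (γ : ResidueField R) :
      (Polynomial.C α * Polynomial.X ^ 2 + Polynomial.C 0 * Polynomial.X
        + Polynomial.C γ).degree = 2 :=
    Polynomial.degree_quadratic hα
  obtain ⟨r, s, hrs⟩ := FiniteField.exists_root_sum_quadratic
    (hdeg (hx.map (residue R)).ne_zero (-residue R c)) (hdeg (hy.map (residue R)).ne_zero 0)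
    (FiniteField.odd_card_of_char_ne_two hchar)
  obtain ⟨r, rfl⟩ := residue_surjective r
  obtain ⟨s, rfl⟩ := residue_surjective s
  refine ⟨r • x + s • y, ?_⟩
  simp only [Polynomial.eval_add, Polynomial.eval_mul, Polynomial.eval_C, Polynomial.eval_pow,
    Polynomial.eval_X] at hrs
  rw [QuadraticMap.map_smul_add_smul, hxy]
  simp only [map_add, map_mul, map_pow, map_zero]
  linear_combination hrs

/-- If `ψ` takes the value `b` modulo the maximal ideal, then every unit represented by
`b t² + ψ w` is represented with `ψ w` a unit: if `ψ w` is not a unit, a suitable reflection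
moves `(t, w)` to a vector whose first coordinate lies in the maximal ideal. -/
theorem QuadraticMap.exists_isUnit_of_residue_eq (h2 : IsUnit (2 : R)) (Q : QuadraticForm R V)
    {a b : R} (ha : IsUnit a) (hb : IsUnit b) {u : V} (hu : residue R (Q u) = residue R b)
    {t : R} {w : V} (h : b * t ^ 2 + Q w = a) :
    ∃ (s : R) (w : V), IsUnit (Q w) ∧ a = b * s ^ 2 + Q w := by
  by_cases hw : IsUnit (Q w)
  · exact ⟨t, w, hw, h.symm⟩
  have hw0 : residue R (Q w) = 0 := (residue_eq_zero_iff _).2 ((mem_maximalIdeal _).2 hw)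
  have ht : IsUnit t := by
    rw [← residue_ne_zero_iff_isUnit]
    intro ht
    apply (ha.map (residue R)).ne_zero
    simp [← h, ht, hw0]
  obtain ⟨i, hi⟩ := ht.exists_right_inv
  obtain ⟨ε, hε, hD⟩ : ∃ ε : R, ε ^ 2 = 1 ∧ IsUnit (b + Q (i • w + ε • u)) := by
    by_contra! hn
    have h1 := (residue_eq_zero_iff _).2 ((mem_maximalIdeal _).2 (hn 1 (by ring)))
    have h3 := (residue_eq_zero_iff _).2 ((mem_maximalIdeal _).2 (hn (-1) (by ring)))
    simp only [QuadraticMap.map_smul_add_smul, map_add, map_mul, map_pow, hw0, hu, map_one,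
      map_neg] at h1 h3
    apply (((h2.mul h2).mul hb).map (residue R)).ne_zero
    simp only [map_mul, map_ofNat]
    linear_combination h1 + h3
  obtain ⟨d, hd⟩ := hD.exists_right_inv
  set v := i • w + ε • u with hv
  set P := QuadraticMap.polar Q w v with hP
  have hQv : Q v = i ^ 2 * Q w + Q u + i * ε * QuadraticMap.polar Q w u := by
    rw [hv, QuadraticMap.map_smul_add_smul, hε, one_mul]
  have hPv : P = i * (2 * Q w) + ε * QuadraticMap.polar Q w u := by
    simp [hP, hv, QuadraticMap.polar_add_right, QuadraticMap.polar_smul_right,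
      QuadraticMap.polar_self]
  set l := (2 * b * t + P) * d with hl
  have hrep : a = b * (t - l) ^ 2 + Q (w - l • v) := by
    have : Q (w - l • v) = Q w + l ^ 2 * Q v - l * P := by
      have := QuadraticMap.map_smul_add_smul Q 1 (-l) w v
      rw [one_smul, neg_smul, ← sub_eq_add_neg] at this
      rw [this]
      ring
    rw [this, ← h]
    linear_combination -(2 * b * t + P) * l * hd
  have hres : residue R (t - l) = 0 := by
    have : t - l = (t * (Q u - b) - i * Q w) * d := by
      rw [hl]
      linear_combination (-t) * hd + t * d * hQv - d * hPv +
        (i * Q w + ε * QuadraticMap.polar Q w u) * d * hi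
    simp [this, hu, hw0]
  refine ⟨t - l, w - l • v, ?_, hrep⟩
  rw [← residue_ne_zero_iff_isUnit]
  intro h0
  apply (ha.map (residue R)).ne_zero
  rw [hrep, map_add, map_mul, map_pow, hres, h0]
  ring

end

/-- **Statement 2.** Let `R` be a local ring containing `1/2` whose residue field has 3 or 5
elements, and let `(W, ψ)` be a quadratic space of rank `≥ 3` over `R`.  Let `b ∈ Rˣ` and
consider the form `q (t, w) = b·t² + ψ w` on `R ⊕ W`.  Then for every unit `a` of `R`
represented by `q` there exist `s ∈ R` and `w ∈ W` such that `ψ w` is a unit of `R` and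
`a = b·s² + ψ w`. -/
theorem statement2 (R : Type) [CommRing R] [IsLocalRing R] [Invertible (2 : R)]
    (hk : Nat.card (IsLocalRing.ResidueField R) = 3 ∨
      Nat.card (IsLocalRing.ResidueField R) = 5)
    (N : QuadSpace R) (hrk : 3 ≤ Module.finrank R N.V) (b : Rˣ) (a : Rˣ)
    (ha : ∃ x : R × N.V, (b : R) * x.1 ^ 2 + N.q x.2 = (a : R)) :
    ∃ (s : R) (w : N.V), IsUnit (N.q w) ∧ (a : R) = (b : R) * s ^ 2 + N.q w := by
  have h2 : IsUnit (2 : R) := isUnit_of_invertible 2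
  have : Finite (ResidueField R) := Nat.finite_of_card_ne_zero (by omega)
  let e := Module.finBasis R N.V
  have hdual (i : Fin (Module.finrank R N.V)) :
      ∃ z, ∀ j, QuadraticMap.polar N.q z (e j) = if j = i then 1 else 0 := by
    obtain ⟨z, hz⟩ := N.nondeg.2 (e.coord i)
    refine ⟨z, fun j => ?_⟩
    rw [← QuadraticMap.polarBilin_apply_apply, hz, Module.Basis.coord_apply,
      Module.Basis.repr_self, Finsupp.single_apply]
  obtain ⟨z₀, hz₀⟩ := hdual ⟨0, by omega⟩
  obtain ⟨z₁, hz₁⟩ := hdual ⟨1, by omega⟩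
  obtain ⟨x, y, hx, hy, hxy⟩ := N.q.exists_orthogonal_isUnit h2
    (e₀ := e ⟨0, by omega⟩) (e₁ := e ⟨1, by omega⟩) (z₀ := z₀) (z₁ := z₁)
    (by simp [hz₀]) (by simp [hz₀]) (by simp [hz₁])
  obtain ⟨u, hu⟩ := N.q.exists_residue_eq h2 hx hy hxy (b : R)
  obtain ⟨⟨t, w⟩, h⟩ := ha
  exact N.q.exists_isUnit_of_residue_eq h2 a.isUnit b.isUnit hu h
end

section
/- Let R be a local ring containing 1/2 whose residue field has 3 or 5 elements, and let (V,φ) and (W,ψ) be quadratic spaces over R, each of rank ≥ 3. Set q := φ ⊥ ψ. Then for every unit a of R represented by q there exist vectors v ∈ V and w ∈ W such that both φ(v) and ψ(w) are units in R and a = φ(v) + ψ(w). -/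
open scoped TensorProduct

open IsLocalRing Polynomial QuadraticMap

theorem FiniteField.exists_mul_sq_add_mul_sq {k : Type*} [Field k] [Finite k]
    (h2 : (2 : k) ≠ 0) {a b : k} (ha : a ≠ 0) (hb : b ≠ 0) (c : k) :
    ∃ x y : k, a * x ^ 2 + b * y ^ 2 = c := by
  have := Fintype.ofFinite k
  have hcard : Fintype.card k % 2 = 1 :=
    FiniteField.odd_card_of_char_ne_two fun h => h2 <| by
      have := CharP.cast_eq_zero k (ringChar k)
      rwa [h, Nat.cast_ofNat] at this
  obtain ⟨x, y, hxy⟩ := FiniteField.exists_root_sum_quadratic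
    (f := C a * X ^ 2 + C 0 * X + C (-c)) (g := C b * X ^ 2 + C 0 * X + C 0)
    (degree_quadratic ha) (degree_quadratic hb) hcard
  refine ⟨x, y, ?_⟩
  simp only [eval_add, eval_mul, eval_C, eval_X, eval_pow] at hxy
  linear_combination hxy

section LocalRing

variable {R V W : Type*} [CommRing R] [IsLocalRing R] [AddCommGroup V] [Module R V]
  [AddCommGroup W] [Module R W]

namespace QuadraticMap

theorem isUnit_apply_of_isUnit_polar {q : QuadraticForm R V} {x y : V}
    (h : IsUnit (polar q x y)) : IsUnit (q (x + y)) ∨ IsUnit (q x) ∨ IsUnit (q y) := by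
  by_contra! hn
  rw [← residue_ne_zero_iff_isUnit] at h
  simp only [← residue_ne_zero_iff_isUnit, not_not] at hn
  exact h (by simp [polar, hn.1, hn.2.1, hn.2.2])

/-- In a vector of unit length, some coordinate is a unit. -/
theorem exists_isUnit_repr {ι : Type*} [Fintype ι] (h2 : IsUnit (2 : R))
    (b : Module.Basis ι R V) {q : QuadraticForm R V} {v : V} (hv : IsUnit (q v)) :
    ∃ i, IsUnit (b.repr v i) := by
  by_contra! h
  have hmem : polarBilin q (∑ i, b.repr v i • b i) v ∈ maximalIdeal R := by
    rw [map_sum, LinearMap.sum_apply]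
    refine Ideal.sum_mem _ fun i _ => ?_
    rw [map_smul, LinearMap.smul_apply, smul_eq_mul]
    exact Ideal.mul_mem_right _ _ ((mem_maximalIdeal _).2 (h i))
  rw [b.sum_repr, polarBilin_apply_apply, polar_self, nsmul_eq_mul, Nat.cast_ofNat] at hmem
  exact (mem_maximalIdeal _).1 hmem (h2.mul hv)

theorem exists_isUnit_apply [Module.Free R V] [Module.Finite R V] {q : QuadraticForm R V}
    (hq : Function.Surjective (polarBilin q)) (hrk : 1 ≤ Module.finrank R V) :
    ∃ v, IsUnit (q v) := by
  let b := Module.finBasis R V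
  let i : Fin (Module.finrank R V) := ⟨0, hrk⟩
  obtain ⟨x, hx⟩ := hq (b.coord i)
  have h : IsUnit (polar q x (b i)) := by
    rw [← polarBilin_apply_apply, hx]
    simp
  rcases isUnit_apply_of_isUnit_polar h with h | h | h <;> exact ⟨_, h⟩

/-- A vector of unit length in a unimodular space of rank at least two is orthogonal to some
vector of unit length. -/
theorem exists_isUnit_apply_polar_eq_zero [Module.Free R V] [Module.Finite R V]
    (h2 : IsUnit (2 : R)) {q : QuadraticForm R V} (hq : Function.Surjective (polarBilin q))
    (hrk : 2 ≤ Module.finrank R V) {v : V} (hv : IsUnit (q v)) :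
    ∃ w, IsUnit (q w) ∧ polar q w v = 0 := by
  let b := Module.finBasis R V
  have : Nontrivial (Fin (Module.finrank R V)) := Fin.nontrivial_iff_two_le.2 hrk
  obtain ⟨i, hi⟩ := exists_isUnit_repr h2 b hv
  obtain ⟨j, hj⟩ := exists_ne i
  obtain ⟨x, hx⟩ := hq (b.repr v i • b.coord j - b.repr v j • b.coord i)
  replace hx (y : V) : polar q x y = b.repr v i * b.repr y j - b.repr v j * b.repr y i := by
    rw [← polarBilin_apply_apply, hx]
    simp
  have hxv : polar q x v = 0 := by rw [hx]; ring
  obtain ⟨s, hs⟩ := (h2.mul hv).exists_left_inv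
  let p := b j - (polar q (b j) v * s) • v
  have hpv : polar q p v = 0 := by
    simp only [p, polar_sub_left, polar_smul_left, polar_self, smul_eq_mul, nsmul_eq_mul,
      Nat.cast_ofNat]
    linear_combination -polar q (b j) v * hs
  have hxp : IsUnit (polar q x p) := by
    simpa [p, polar_sub_right, polar_smul_right, hxv, hx (b j), hj] using hi
  rcases isUnit_apply_of_isUnit_polar hxp with h | h | h
  · exact ⟨_, h, by rw [polar_add_left, hxv, hpv, add_zero]⟩
  · exact ⟨_, h, hxv⟩
  · exact ⟨_, h, hpv⟩

/-- Over a finite residue field, a unimodular form of rank at least two takes values in every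
residue class. -/
theorem exists_residue_apply_eq [Finite (ResidueField R)] [Module.Free R V] [Module.Finite R V]
    (h2 : IsUnit (2 : R)) {q : QuadraticForm R V} (hq : Function.Surjective (polarBilin q))
    (hrk : 2 ≤ Module.finrank R V) (c : ResidueField R) : ∃ v, residue R (q v) = c := by
  obtain ⟨v, hv⟩ := exists_isUnit_apply hq (one_le_two.trans hrk)
  obtain ⟨w, hw, hwv⟩ := exists_isUnit_apply_polar_eq_zero h2 hq hrk hv
  rw [← residue_ne_zero_iff_isUnit] at h2 hv hw
  rw [map_ofNat] at h2
  obtain ⟨x, y, rfl⟩ := FiniteField.exists_mul_sq_add_mul_sq h2 hw hv c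
  obtain ⟨x, rfl⟩ := residue_surjective x
  obtain ⟨y, rfl⟩ := residue_surjective y
  refine ⟨x • w + y • v, ?_⟩
  rw [QuadraticMap.map_add q, polar_smul_left, polar_smul_right, hwv]
  simp only [QuadraticMap.map_smul, smul_eq_mul, mul_zero, add_zero, map_add, map_mul]
  ring

theorem residue_apply_sub_smul_sub (q : QuadraticForm R V) {t : R} (ht : residue R t = 1)
    (x v : V) : residue R (q (x - t • (x - v))) = residue R (q v) := by
  have h : x - t • (x - v) = v + (1 - t) • (x - v) := by module
  rw [h, QuadraticMap.map_add q, QuadraticMap.map_smul, polar_smul_right]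
  simp [ht]

/-- If `z` and `z'` have the same length modulo the maximal ideal and their difference has unit
length, then the reflection in `z - z'` sends `z` to a vector congruent to `z'`. -/
theorem exists_apply_sub_smul_sub_eq {q : QuadraticForm R V} {z z' : V}
    (h : residue R (q z') = residue R (q z)) (hu : IsUnit (q (z - z'))) :
    ∃ t : R, residue R t = 1 ∧ q (z - t • (z - z')) = q z := by
  obtain ⟨s, hs⟩ := hu.exists_left_inv
  have hp : polar q z (z - z') = q (z - z') + q z - q z' := by
    have := QuadraticMap.map_add q z (-(z - z'))
    rw [polar_neg_right, QuadraticMap.map_neg, neg_sub, add_sub_cancel] at this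
    linear_combination this
  refine ⟨s * polar q z (z - z'), ?_, ?_⟩
  · have := congrArg (residue R) hs
    rw [map_mul, map_one] at this
    rw [hp, map_mul, map_sub, map_add, h, add_sub_cancel_right, this]
  · rw [sub_eq_add_neg, ← neg_smul, QuadraticMap.map_add q, QuadraticMap.map_smul,
      polar_smul_right]
    simp only [smul_eq_mul]
    linear_combination s * polar q z (z - z') ^ 2 * hs

/-- If a unit is a value of `φ ⊥ ψ` and is congruent to a sum of two unit values of `φ` and `ψ`,
then it is itself such a sum. -/
theorem exists_isUnit_add_eq (h2 : IsUnit (2 : R)) {φ : QuadraticForm R V}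
    {ψ : QuadraticForm R W} {x v : V} {y w : W} (ha : IsUnit (φ x + ψ y))
    (hv : IsUnit (φ v)) (hw : IsUnit (ψ w))
    (h : residue R (φ v + ψ w) = residue R (φ x + ψ y)) :
    ∃ (v' : V) (w' : W), IsUnit (φ v') ∧ IsUnit (ψ w') ∧ φ v' + ψ w' = φ x + ψ y := by
  wlog hu : IsUnit ((φ.prod ψ) ((x, y) - (v, w))) generalizing v w
  · refine this (v := -v) (w := -w) (by simpa) (by simpa) (by simpa) ?_
    rw [← residue_ne_zero_iff_isUnit, not_not] at hu
    rw [← residue_ne_zero_iff_isUnit] at h2 ha ⊢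
    have key : (φ.prod ψ) ((x, y) - (-v, -w)) =
        2 * (φ x + ψ y) + 2 * (φ v + ψ w) - (φ.prod ψ) ((x, y) - (v, w)) := by
      simp only [prod_apply, Prod.mk_sub_mk]
      simp only [sub_eq_add_neg, neg_neg, QuadraticMap.map_add φ, QuadraticMap.map_add ψ,
        polar_neg_right, QuadraticMap.map_neg]
      ring
    rw [key, map_sub, hu, sub_zero, map_add, map_mul, map_mul, h]
    have h4 : residue R 2 * residue R (φ x + ψ y) + residue R 2 * residue R (φ x + ψ y) =
        residue R 2 * residue R 2 * residue R (φ x + ψ y) := by rw [map_ofNat]; ring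
    rw [h4]
    exact mul_ne_zero (mul_ne_zero h2 h2) ha
  obtain ⟨t, ht, heq⟩ := exists_apply_sub_smul_sub_eq (q := φ.prod ψ) (by simpa using h) hu
  refine ⟨x - t • (x - v), y - t • (y - w), ?_, ?_, heq⟩
  · rwa [← residue_ne_zero_iff_isUnit, residue_apply_sub_smul_sub φ ht,
      residue_ne_zero_iff_isUnit]
  · rwa [← residue_ne_zero_iff_isUnit, residue_apply_sub_smul_sub ψ ht,
      residue_ne_zero_iff_isUnit]

end QuadraticMap

end LocalRing

/-- **Statement 3.** Let `R` be a local ring containing `1/2` whose residue field has 3 or 5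
elements, and let `(V, φ)` and `(W, ψ)` be quadratic spaces over `R`, each of rank `≥ 3`.
Set `q := φ ⊥ ψ`.  Then for every unit `a` of `R` represented by `q` there exist `v ∈ V` and
`w ∈ W` such that both `φ v` and `ψ w` are units of `R` and `a = φ v + ψ w`. -/
theorem statement3 (R : Type) [CommRing R] [IsLocalRing R] [Invertible (2 : R)]
    (hk : Nat.card (IsLocalRing.ResidueField R) = 3 ∨
      Nat.card (IsLocalRing.ResidueField R) = 5)
    (M N : QuadSpace R) (hrkM : 3 ≤ Module.finrank R M.V) (hrkN : 3 ≤ Module.finrank R N.V)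
    (a : Rˣ) (ha : ∃ x : M.V × N.V, M.q x.1 + N.q x.2 = (a : R)) :
    ∃ (v : M.V) (w : N.V),
      IsUnit (M.q v) ∧ IsUnit (N.q w) ∧ (a : R) = M.q v + N.q w := by
  have h2 : IsUnit (2 : R) := isUnit_of_invertible 2
  have : Finite (ResidueField R) := Nat.finite_of_card_ne_zero (by omega)
  obtain ⟨⟨x, y⟩, hxy⟩ := ha
  have h2' := (residue_ne_zero_iff_isUnit _).2 h2
  have ha' := (residue_ne_zero_iff_isUnit _).2 a.isUnit
  obtain ⟨v, hv⟩ := exists_residue_apply_eq h2 M.nondeg.2 (by omega)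
    (residue R 2 * residue R a)
  obtain ⟨w, hw⟩ := exists_residue_apply_eq h2 N.nondeg.2 (by omega) (-residue R a)
  have hv' : IsUnit (M.q v) := by
    rw [← residue_ne_zero_iff_isUnit, hv]
    exact mul_ne_zero h2' ha'
  have hw' : IsUnit (N.q w) := by
    rw [← residue_ne_zero_iff_isUnit, hw]
    exact neg_ne_zero.2 ha'
  obtain ⟨v', w', hv'', hw'', h⟩ := exists_isUnit_add_eq h2 (x := x) (y := y)
    (hxy ▸ a.isUnit) hv' hw' (by
      rw [map_add, hv, hw, hxy, map_ofNat]
      ring)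
  exact ⟨v', w', hv'', hw'', (h.trans hxy).symm⟩
end

section
/- Let R be a local ring containing 1/2 (if R is not a field, assume its residue field has at least 5 elements). In the Witt K-theory ring KW_*(R), one has [−a]·[a] = 0 for every unit a of R. -/
/-- The defining relations of the Witt `K`-theory ring of `R`: the generator `[a]`
(for `a ∈ Rˣ`) is encoded as `some a` (in degree `1`), and the generator `η` as
`none` (in degree `-1`). -/
inductive KWRel (R : Type) [CommRing R] :
    FreeAlgebra ℤ (Option Rˣ) → FreeAlgebra ℤ (Option Rˣ) → Prop
  /-- (WK1) `η·[a] = [a]·η`. -/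
  | comm (a : Rˣ) : KWRel R (FreeAlgebra.ι ℤ none * FreeAlgebra.ι ℤ (some a))
      (FreeAlgebra.ι ℤ (some a) * FreeAlgebra.ι ℤ none)
  /-- (WK2) `[ab] = [a] + [b] - η·[a]·[b]`. -/
  | mul (a b : Rˣ) : KWRel R (FreeAlgebra.ι ℤ (some (a * b)))
      (FreeAlgebra.ι ℤ (some a) + FreeAlgebra.ι ℤ (some b) -
        FreeAlgebra.ι ℤ none * FreeAlgebra.ι ℤ (some a) * FreeAlgebra.ι ℤ (some b))
  /-- (WK3) `[a]·[1-a] = 0` for `a, 1-a ∈ Rˣ`. -/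
  | steinberg (a b : Rˣ) (h : (a : R) + (b : R) = 1) :
      KWRel R (FreeAlgebra.ι ℤ (some a) * FreeAlgebra.ι ℤ (some b)) 0
  /-- (WK4) `2 = η·[-1]`. -/
  | hyperbolic : KWRel R 2 (FreeAlgebra.ι ℤ none * FreeAlgebra.ι ℤ (some (-1)))

/-- The Witt `K`-theory ring `KW_*(R)` of `R`: the quotient of the free `ℤ`-algebra on
generators `[a]` (`a ∈ Rˣ`, degree `1`) and `η` (degree `-1`) by the two-sided ideal
generated by the relations (WK1)–(WK4). -/
def KW (R : Type) [CommRing R] := RingQuot (KWRel R)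

noncomputable instance (R : Type) [CommRing R] : Ring (KW R) :=
  inferInstanceAs (Ring (RingQuot (KWRel R)))

namespace KW

variable (R : Type) [CommRing R]

/-- The degree-one generator `[a]` of `KW_*(R)`. -/
noncomputable def gen (a : Rˣ) : KW R :=
  RingQuot.mkRingHom (KWRel R) (FreeAlgebra.ι ℤ (some a))

/-- The degree-minus-one generator `η` of `KW_*(R)`. -/
noncomputable def eta : KW R :=
  RingQuot.mkRingHom (KWRel R) (FreeAlgebra.ι ℤ none)

/-- `⟨a⟩ := 1 - η·[a]` in `KW_0(R)`. -/
noncomputable def gu (a : Rˣ) : KW R := 1 - eta R * gen R a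

end KW

namespace KW

variable {R : Type} [CommRing R]

theorem eta_mul_gen (a : Rˣ) : eta R * gen R a = gen R a * eta R := by
  have h := RingQuot.mkRingHom_rel (KWRel.comm a)
  rw [map_mul, map_mul] at h
  exact h

theorem gen_mul (a b : Rˣ) :
    gen R (a * b) = gen R a + gen R b - eta R * gen R a * gen R b := by
  have h := RingQuot.mkRingHom_rel (KWRel.mul a b)
  rw [map_sub, map_add, map_mul, map_mul] at h
  exact h

theorem gen_mul_gen_of_add_eq_one {a b : Rˣ} (hab : (a : R) + b = 1) :
    gen R a * gen R b = 0 := by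
  have h := RingQuot.mkRingHom_rel (KWRel.steinberg a b hab)
  rw [map_mul, map_zero] at h
  exact h

theorem eta_mul_gen_neg_one : eta R * gen R (-1) = 2 := by
  have h := RingQuot.mkRingHom_rel (KWRel.hyperbolic (R := R))
  rw [map_mul, map_ofNat] at h
  exact h.symm

theorem gen_one : gen R 1 = 0 := by
  have h := gen_mul (R := R) (-1) (-1)
  rw [eta_mul_gen_neg_one, neg_one_mul, neg_neg] at h
  rw [h]
  noncomm_ring

theorem gen_neg (a : Rˣ) : gen R (-a) = gen R (-1) - gen R a := by
  rw [← neg_one_mul a, gen_mul, eta_mul_gen_neg_one]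
  noncomm_ring

theorem eta_mul_gen_mul_gen_comm (a b : Rˣ) :
    eta R * (gen R a * gen R b) = eta R * (gen R b * gen R a) := by
  have h := gen_mul a b
  rw [mul_comm, gen_mul, add_comm, sub_right_inj, mul_assoc, mul_assoc] at h
  exact h.symm

/-- Away from `1 + 𝔪`, the identity `-a = (1 - a) / (1 - a⁻¹)` reduces the claim to the Steinberg
relation. -/
theorem gen_neg_mul_gen_of_isUnit_one_sub {a : Rˣ} (ha : IsUnit (1 - (a : R))) :
    gen R (-a) * gen R a = 0 := by
  obtain ⟨u, hu⟩ := ha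
  have hv : ((-a⁻¹ * u : Rˣ) : R) + (a⁻¹ : Rˣ) = 1 := by
    push_cast
    rw [hu]
    linear_combination a.inv_mul
  have hmul : -a * (-a⁻¹ * u) = u := by simp
  generalize -a⁻¹ * u = v at hv hmul
  have hua : gen R u * gen R a = 0 := gen_mul_gen_of_add_eq_one (by rw [hu]; ring)
  have hva' : gen R v * gen R a⁻¹ = 0 := gen_mul_gen_of_add_eq_one hv
  have hva : gen R v * gen R a = 0 := by
    have h := congrArg (gen R v * ·) (gen_mul a a⁻¹)
    have h0 : gen R v * (eta R * (gen R a * gen R a⁻¹)) = 0 := by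
      rw [eta_mul_gen_mul_gen_comm, ← mul_assoc, ← eta_mul_gen, mul_assoc, ← mul_assoc (gen R v),
        hva', zero_mul, mul_zero]
    simpa [gen_one, mul_sub, mul_add, hva', h0, mul_assoc, eq_comm] using h
  rw [← hmul, gen_mul, sub_mul, add_mul, mul_assoc _ (gen R v), hva] at hua
  simpa using hua

theorem gen_mul_self_of_isUnit_one_sub {a : Rˣ} (ha : IsUnit (1 - (a : R))) :
    gen R a * gen R a = gen R (-1) * gen R a := by
  have h := gen_neg_mul_gen_of_isUnit_one_sub ha
  rw [gen_neg, sub_mul, sub_eq_zero] at h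
  exact h.symm

/-- For products of two units outside `1 + 𝔪`, the claim measures their failure to commute. -/
theorem gen_neg_mul_gen_mul {b c : Rˣ} (hb : IsUnit (1 - (b : R))) (hc : IsUnit (1 - (c : R))) :
    gen R (-(b * c)) * gen R (b * c) = gen R b * gen R c - gen R c * gen R b := by
  have hbb := gen_mul_self_of_isUnit_one_sub hb
  have hcc := gen_mul_self_of_isUnit_one_sub hc
  have hbc := eta_mul_gen_mul_gen_comm b c
  have hm := eta_mul_gen_neg_one (R := R)
  have heb := eta_mul_gen b
  have hec := eta_mul_gen c
  have hem := eta_mul_gen (-1 : Rˣ)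
  rw [gen_neg, gen_mul]
  generalize gen R b = x at *
  generalize gen R c = y at *
  generalize gen R (-1) = m at *
  generalize eta R = e at *
  have hexx : e * (x * x) = 2 * x := by rw [hbb, ← mul_assoc, hm]
  have heyy : e * (y * y) = 2 * y := by rw [hcc, ← mul_assoc, hm]
  have h1 : m * (e * x * y) = 2 * (x * y) := by
    rw [← mul_assoc, ← mul_assoc, ← hem, hm, mul_assoc]
  have h2 : x * (e * x * y) = 2 * (x * y) := by
    rw [← mul_assoc, ← mul_assoc, ← heb, mul_assoc e, hexx, mul_assoc]
  have h3 : y * (e * x * y) = 2 * (x * y) := by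
    rw [← mul_assoc, ← mul_assoc, ← hec, mul_assoc e, ← hbc, ← mul_assoc, mul_assoc,
      heb, mul_assoc, heyy]
    noncomm_ring
  have h4 : e * x * y * x = 2 * (x * y) := by
    rw [heb, mul_assoc, mul_assoc, ← hbc, ← mul_assoc, ← mul_assoc, ← heb, mul_assoc e, hexx,
      mul_assoc]
  have h5 : e * x * y * y = 2 * (x * y) := by
    rw [heb, mul_assoc, mul_assoc, ← mul_assoc e, mul_assoc e, heyy]
    noncomm_ring
  have h6 : e * x * y * (e * x * y) = 4 * (x * y) := by
    have h : e * x * y * (e * x * y) = e * x * (y * (e * x * y)) := mul_assoc _ _ _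
    have h' : e * x * (2 * (x * y)) = 2 * (e * (x * x)) * y := by noncomm_ring
    rw [h, h3, h', hexx]
    noncomm_ring
  have key : (m - (x + y - e * x * y)) * (x + y - e * x * y) =
      m * x + m * y - m * (e * x * y) - x * x - x * y - y * x - y * y + x * (e * x * y)
      + y * (e * x * y) + e * x * y * x + e * x * y * y - e * x * y * (e * x * y) := by
    noncomm_ring
  rw [key, h1, h2, h3, h4, h5, h6, hbb, hcc]
  noncomm_ring

/-- The case `a ∈ 1 + 𝔪`: write `a = b * (d * d)`, so that `b`, `d`, `d * d` and `b * d` all lie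
outside `1 + 𝔪`. -/
theorem gen_neg_mul_gen_of_not_isUnit_one_sub [IsLocalRing R] {a d : Rˣ}
    (ha : ¬ IsUnit (1 - (a : R))) (hd : IsUnit (1 - (d : R)))
    (hdd : IsUnit (1 - ((d * d : Rˣ) : R))) :
    gen R (-a) * gen R a = 0 := by
  obtain ⟨b, rfl⟩ : ∃ b, a = b * (d * d) := ⟨a * (d * d)⁻¹, (inv_mul_cancel_right a _).symm⟩
  have key (r : R) : IsUnit (1 - r) ↔ 1 ≠ IsLocalRing.residue R r := by
    rw [← IsLocalRing.residue_ne_zero_iff_isUnit, map_sub, map_one, sub_ne_zero]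
  have ha' := not_not.1 (mt (key _).2 ha)
  rw [Units.val_mul, map_mul] at ha'
  have hb : IsUnit (1 - (b : R)) := (key _).2 fun h => (key _).1 hdd <| by
    rwa [← h, one_mul] at ha'
  have hbd : IsUnit (1 - ((b * d : Rˣ) : R)) := (key _).2 fun h => (key _).1 hd <| by
    rw [Units.val_mul, map_mul] at h
    rwa [Units.val_mul, map_mul, ← mul_assoc, ← h, one_mul] at ha'
  have hcomm : Commute (gen R b) (gen R d) := by
    rw [commute_iff_eq, ← sub_eq_zero, ← gen_neg_mul_gen_mul hb hd,
      gen_neg_mul_gen_of_isUnit_one_sub hbd]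
  have hcomm' : Commute (gen R b) (gen R (d * d)) := by
    rw [gen_mul]
    have heta : Commute (gen R b) (eta R) := (eta_mul_gen b).symm
    exact (hcomm.add_right hcomm).sub_right ((heta.mul_right hcomm).mul_right hcomm)
  rw [gen_neg_mul_gen_mul hb hdd, hcomm'.eq, sub_self]

end KW

open IsLocalRing in
theorem exists_unit_isUnit_one_sub_of_five_le {R : Type} [CommRing R] [IsLocalRing R]
    (hR : 5 ≤ Cardinal.mk (ResidueField R)) :
    ∃ d : Rˣ, IsUnit (1 - (d : R)) ∧ IsUnit (1 - ((d * d : Rˣ) : R)) := by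
  classical
  obtain ⟨x, hx⟩ : ∃ x : ResidueField R, x ∉ ({0, 1, -1} : Finset (ResidueField R)) := by
    by_contra! h
    have hle : Cardinal.mk (ResidueField R) ≤ 3 := by
      rw [← Cardinal.mk_univ, ← Set.eq_univ_of_forall h]
      exact Cardinal.mk_coe_finset.trans_le (mod_cast Finset.card_le_three)
    exact absurd (hR.trans hle) (by norm_num)
  simp only [Finset.mem_insert, Finset.mem_singleton, not_or] at hx
  obtain ⟨hx0, hx1, hx2⟩ := hx
  obtain ⟨r, rfl⟩ := residue_surjective x
  obtain ⟨d, rfl⟩ := (residue_ne_zero_iff_isUnit r).1 hx0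
  refine ⟨d, ?_, ?_⟩
  · rw [← residue_ne_zero_iff_isUnit, map_sub, map_one, sub_ne_zero]
    exact Ne.symm hx1
  · rw [← residue_ne_zero_iff_isUnit, Units.val_mul, map_sub, map_one, map_mul, sub_ne_zero,
      ne_comm, Ne, mul_self_eq_one_iff]
    tauto

open IsLocalRing in
/-- **Statement 8.** Let `R` be a local ring containing `1/2` (if `R` is not a field its
residue field has at least 5 elements).  In `KW_*(R)` one has `[-a]·[a] = 0` for every
unit `a` of `R`. -/
theorem statement8 (R : Type) [CommRing R] [IsLocalRing R] [Invertible (2 : R)]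
    (hR : IsField R ∨ 5 ≤ Cardinal.mk (ResidueField R)) (a : Rˣ) :
    KW.gen R (-a) * KW.gen R a = 0 := by
  by_cases ha : IsUnit (1 - (a : R))
  · exact KW.gen_neg_mul_gen_of_isUnit_one_sub ha
  rcases hR with hF | h5
  · have h1 : a = 1 := by
      by_contra hne
      obtain ⟨c, hc⟩ := hF.mul_inv_cancel (a := 1 - (a : R))
        (sub_ne_zero.2 fun h => hne (Units.ext h.symm))
      exact ha (IsUnit.of_mul_eq_one c hc)
    rw [h1, KW.gen_one, mul_zero]
  · obtain ⟨d, hd, hdd⟩ := exists_unit_isUnit_one_sub_of_five_le h5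
    exact KW.gen_neg_mul_gen_of_not_isUnit_one_sub ha hd hdd
end

section
/- Let R be a local ring containing 1/2 (if R is not a field, assume its residue field has at least 5 elements). In the Witt K-theory ring KW_*(R), one has [r]·[st] + [s]·[t] = [rs]·[t] + [r]·[s] for all units r, s, t of R. -/
theorem KW.eta_mul_gen_s7 (R : Type) [CommRing R] (a : Rˣ) :
    KW.eta R * KW.gen R a = KW.gen R a * KW.eta R := by
  have h := RingQuot.mkRingHom_rel (KWRel.comm a)
  rwa [map_mul, map_mul] at h

theorem KW.gen_mul_s7 (R : Type) [CommRing R] (a b : Rˣ) :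
    KW.gen R (a * b) =
      KW.gen R a + KW.gen R b - KW.eta R * KW.gen R a * KW.gen R b := by
  have h := RingQuot.mkRingHom_rel (KWRel.mul a b)
  rwa [map_sub, map_add, map_mul, map_mul] at h

open IsLocalRing in
/-- **Statement 12.** Let `R` be a local ring containing `1/2` (if `R` is not a field its
residue field has at least 5 elements).  In `KW_*(R)` one has
`[r]·[st] + [s]·[t] = [rs]·[t] + [r]·[s]` for all units `r, s, t` of `R`. -/
theorem statement12 (R : Type) [CommRing R] [IsLocalRing R] [Invertible (2 : R)]
    (hR : IsField R ∨ 5 ≤ Cardinal.mk (ResidueField R)) (r s t : Rˣ) :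
    KW.gen R r * KW.gen R (s * t) + KW.gen R s * KW.gen R t =
      KW.gen R (r * s) * KW.gen R t + KW.gen R r * KW.gen R s := by
  have h : KW.gen R r * (KW.eta R * KW.gen R s * KW.gen R t) =
      KW.eta R * KW.gen R r * KW.gen R s * KW.gen R t := by
    rw [KW.eta_mul_gen_s7 R r]
    simp only [mul_assoc]
  rw [KW.gen_mul_s7, KW.gen_mul_s7, mul_sub, mul_add, sub_mul, add_mul, h]
  abel
end
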